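/- arXiv:2107.09902 — 2 statements merged into one kernel-verified Lean document; each statement's English description precedes it below -/
import Mathlib

section
/- For all m, t ∈ ℕ and 1 ≤ r ≤ m, the t-th generalized covering radius of RM(r,m) satisfies R_t(r,m) ≤ (1 − 1/2^t)·2^m − (√(2^t − 1)/2^t)·C(m,r). -/
open Classical in
noncomputable def tWeight {ι F : Type*} [Fintype ι] [Zero F] {t : ℕ} (v : Fin t → ι → F) : ℕ :=
  (Finset.univ.filter fun j : ι => ∃ i, v i j ≠ (0 : F)).card

noncomputable def genCovDist {ι F : Type*} [Fintype ι] [AddGroup F] {t : ℕ} (v c : Fin t → ι → F) : ℕ :=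
  tWeight (v - c)

noncomputable def genCovRadius {ι F : Type*} [Fintype ι] [AddGroup F] (C : Set (ι → F)) (t : ℕ) : ℕ :=
  sInf {r : ℕ | ∀ v : Fin t → ι → F, ∃ c : Fin t → ι → F, (∀ i, c i ∈ C) ∧ genCovDist v c ≤ r}

def RM (r m : ℕ) : Set ((Fin m → ZMod 2) → ZMod 2) :=
  {f | ∃ p : MvPolynomial (Fin m) (ZMod 2), p.totalDegree ≤ r ∧ ∀ x, MvPolynomial.eval x p = f x}

lemma gcr_spec {ι F : Type*} [Fintype ι] [AddGroup F] (C : Set (ι → F)) (t : ℕ)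
    (h0 : C.Nonempty) (v : Fin t → ι → F) :
    ∃ c : Fin t → ι → F, (∀ i, c i ∈ C) ∧ genCovDist v c ≤ genCovRadius C t := by
  have hne : {r : ℕ | ∀ v : Fin t → ι → F, ∃ c : Fin t → ι → F,
      (∀ i, c i ∈ C) ∧ genCovDist v c ≤ r}.Nonempty := by
    obtain ⟨g, hg⟩ := h0
    refine ⟨Fintype.card ι, fun v => ⟨fun _ => g, fun _ => hg, ?_⟩⟩
    exact Finset.card_le_univ _
  exact Nat.sInf_mem hne v

lemma gcr_le {ι F : Type*} [Fintype ι] [AddGroup F] (C : Set (ι → F)) (t k : ℕ)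
    (h : ∀ v : Fin t → ι → F, ∃ c : Fin t → ι → F, (∀ i, c i ∈ C) ∧ genCovDist v c ≤ k) :
    genCovRadius C t ≤ k := Nat.sInf_le h

lemma RM_zero_mem (r m : ℕ) : (0 : (Fin m → ZMod 2) → ZMod 2) ∈ RM r m :=
  ⟨0, by simp, by simp⟩

lemma RM_glue {r m : ℕ} {g h : (Fin m → ZMod 2) → ZMod 2} (hg : g ∈ RM (r + 1) m)
    (hh : h ∈ RM r m) :
    (fun x : Fin (m + 1) → ZMod 2 => g (Fin.tail x) + x 0 * h (Fin.tail x)) ∈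
      RM (r + 1) (m + 1) := by
  obtain ⟨p, hp, hp'⟩ := hg
  obtain ⟨q, hq, hq'⟩ := hh
  refine ⟨MvPolynomial.rename Fin.succ p + MvPolynomial.X 0 * MvPolynomial.rename Fin.succ q,
    ?_, ?_⟩
  · refine (MvPolynomial.totalDegree_add _ _).trans (max_le ?_ ?_)
    · exact (MvPolynomial.totalDegree_rename_le _ _).trans hp
    · refine (MvPolynomial.totalDegree_mul _ _).trans ?_
      have h1 := (MvPolynomial.totalDegree_rename_le (Fin.succ : Fin m → Fin (m+1)) q).trans hq
      have h2 : (MvPolynomial.X 0 : MvPolynomial (Fin (m+1)) (ZMod 2)).totalDegree ≤ 1 := by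
        simp
      omega
  · intro x
    simp only [map_add, map_mul, MvPolynomial.eval_rename, MvPolynomial.eval_X]
    rw [← hp', ← hq']
    rfl

lemma zmod2_cases (a : ZMod 2) : a = 0 ∨ a = 1 := by
  revert a; decide

lemma RM_full (m : ℕ) : ∀ f : (Fin m → ZMod 2) → ZMod 2, f ∈ RM m m := by
  induction m with
  | zero =>
    intro f
    refine ⟨MvPolynomial.C (f 0), by simp, fun x => ?_⟩
    rw [Subsingleton.elim x 0]; simp
  | succ m ih =>
    intro f
    have h0 : (fun x : Fin m → ZMod 2 => f (Fin.cons 0 x)) ∈ RM (m + 1) m := by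
      obtain ⟨p, hp, hp'⟩ := ih (fun x : Fin m → ZMod 2 => f (Fin.cons 0 x))
      exact ⟨p, by omega, hp'⟩
    have h1 := ih (fun x : Fin m → ZMod 2 => f (Fin.cons 1 x) - f (Fin.cons 0 x))
    convert RM_glue h0 h1 using 1
    funext x
    rcases zmod2_cases (x 0) with hx | hx
    · have : x = Fin.cons 0 (Fin.tail x) := by rw [← hx, Fin.cons_self_tail]
      simp only [hx]
      rw [← this]; ring
    · have : x = Fin.cons 1 (Fin.tail x) := by rw [← hx, Fin.cons_self_tail]
      simp only [hx]
      rw [← this]; ring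

lemma tWeight_split {m t : ℕ} (v : Fin t → (Fin (m + 1) → ZMod 2) → ZMod 2) :
    tWeight v = tWeight (fun i x => v i (Fin.cons 0 x)) + tWeight (fun i x => v i (Fin.cons 1 x)) := by
  classical
  unfold tWeight
  simp only [Finset.card_filter]
  rw [← (Fin.consEquiv (fun _ : Fin (m + 1) => ZMod 2)).sum_comp, Fintype.sum_prod_type]
  have : ∀ g : ZMod 2 → ℕ, ∑ a, g a = g 0 + g 1 := fun g => Fin.sum_univ_two g
  rw [this]
  congr 1 <;>
  · refine Finset.sum_congr rfl fun x _ => ?_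
    congr 1

lemma gcr_rec (r m t : ℕ) :
    genCovRadius (RM (r + 1) (m + 1)) t ≤ genCovRadius (RM r m) t + genCovRadius (RM (r + 1) m) t := by
  apply gcr_le
  intro v
  obtain ⟨g, hg, hg'⟩ := gcr_spec (RM (r + 1) m) t ⟨_, RM_zero_mem _ _⟩
    (fun i x => v i (Fin.cons 0 x))
  obtain ⟨h, hh, hh'⟩ := gcr_spec (RM r m) t ⟨_, RM_zero_mem _ _⟩
    (fun i x => v i (Fin.cons 1 x) - g i x)
  refine ⟨fun i x => g i (Fin.tail x) + x 0 * h i (Fin.tail x), fun i => RM_glue (hg i) (hh i), ?_⟩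
  unfold genCovDist at *
  rw [tWeight_split]
  refine le_of_eq_of_le ?_ (Nat.add_le_add hh' hg')
  rw [add_comm]
  congr 2
  · funext i x
    simp [sub_sub]
  · funext i x
    simp

lemma moment {Ω X : Type*} [Fintype Ω] [Fintype X] [Nonempty Ω] [Nonempty X]
    (I : X → Ω → ℝ) (hI : ∀ x w, I x w * I x w = I x w) (p : ℝ) (hp : 0 < p) (hp2 : p ≤ 1 / 2)
    (h1 : ∀ x, ∑ w, I x w = p * Fintype.card Ω)
    (h2 : ∀ x y, x ≠ y → ∑ w, I x w * I y w = p ^ 2 * Fintype.card Ω)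
    (h3 : ∀ x y z, x ≠ y → x ≠ z → y ≠ z →
      ∑ w, I x w * I y w * I z w = p ^ 3 * Fintype.card Ω) :
    ∃ w, Fintype.card X * p + √(Fintype.card X * p * (1 - p)) ≤ ∑ x, I x w := by
  classical
  set W : ℝ := (Fintype.card Ω : ℝ) with hW
  set n : ℝ := (Fintype.card X : ℝ) with hn
  have hWpos : 0 < W := by simp only [hW]; exact_mod_cast Fintype.card_pos
  have hnpos : 0 < n := by simp only [hn]; exact_mod_cast Fintype.card_pos
  set N : Ω → ℝ := fun w => ∑ x, I x w with hN
  have e1 : ∑ w, N w = n * p * W := by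
    simp only [hN]
    rw [Finset.sum_comm]
    simp only [h1, Finset.sum_const, Finset.card_univ, nsmul_eq_mul]
    ring
  have f2 : ∀ x y, ∑ w, I x w * I y w = p ^ 2 * W + (if x = y then (p - p ^ 2) * W else 0) := by
    intro x y
    split_ifs with h
    · subst h
      simp only [hI, h1]; ring
    · rw [h2 x y h]; ring
  have e2 : ∑ w, N w ^ 2 = (n ^ 2 * p ^ 2 + n * (p - p ^ 2)) * W := by
    simp only [hN, pow_two (∑ x, I x _), Finset.sum_mul_sum]
    rw [Finset.sum_comm]
    simp_rw [Finset.sum_comm (s := (Finset.univ : Finset Ω)), f2, Finset.sum_add_distrib]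
    simp only [Finset.sum_const, Finset.card_univ, nsmul_eq_mul, Finset.sum_ite_eq,
      Finset.mem_univ, if_true]
    ring
  have f3 : ∀ x y z, ∑ w, I x w * I y w * I z w = p ^ 3 * W
      + (if x = y then (p ^ 2 - p ^ 3) * W else 0)
      + (if x = z then (p ^ 2 - p ^ 3) * W else 0)
      + (if y = z then (p ^ 2 - p ^ 3) * W else 0)
      + (if x = y then (if y = z then (p - 3 * p ^ 2 + 2 * p ^ 3) * W else 0) else 0) := by
    intro x y z
    by_cases hxy : x = y
    · subst hxy
      simp only [hI, f2]
      by_cases hxz : x = z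
      · simp [hxz]; ring
      · simp [hxz]; ring
    · by_cases hxz : x = z
      · subst hxz
        have : ∀ w, I x w * I y w * I x w = I x w * I y w := fun w => by
          rw [mul_right_comm, hI]
        simp only [this, f2]
        simp [hxy, Ne.symm hxy]
        ring
      · by_cases hyz : y = z
        · subst hyz
          simp only [mul_assoc, hI, f2]
          simp [hxy]
          ring
        · rw [h3 x y z hxy hxz hyz]; simp [hxy, hxz, hyz]
  have e3 : ∑ w, N w ^ 3 = (n ^ 3 * p ^ 3 + 3 * n ^ 2 * (p ^ 2 - p ^ 3)
      + n * (p - 3 * p ^ 2 + 2 * p ^ 3)) * W := by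
    have : ∀ w, N w ^ 3 = ∑ x, ∑ y, ∑ z, I x w * I y w * I z w := by
      intro w
      rw [pow_three', hN]
      simp only [Finset.sum_mul_sum]
      simp only [Finset.sum_mul]
      exact Finset.sum_congr rfl fun x _ => Finset.sum_comm
    simp only [this]
    rw [Finset.sum_comm]
    have : ∀ x, ∑ w, ∑ y, ∑ z, I x w * I y w * I z w = ∑ y, ∑ z, ∑ w, I x w * I y w * I z w := by
      intro x
      rw [Finset.sum_comm]
      exact Finset.sum_congr rfl fun y _ => Finset.sum_comm
    simp only [this, f3, Finset.sum_add_distrib]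
    simp [← hn]
    ring
  obtain ⟨w0, -, hw0⟩ := Finset.exists_max_image (Finset.univ : Finset Ω) N Finset.univ_nonempty
  refine ⟨w0, ?_⟩
  change _ ≤ N w0
  set σ := √(n * p * (1 - p)) with hσ
  have hvar : 0 < n * p * (1 - p) := by
    have : 0 < 1 - p := by linarith
    positivity
  have hσpos : 0 < σ := Real.sqrt_pos.2 hvar
  have hσ2 : σ ^ 2 = n * p * (1 - p) := Real.sq_sqrt hvar.le
  have key : 0 ≤ ∑ w, (N w0 - N w) * (N w - n * p + σ) ^ 2 :=
    Finset.sum_nonneg fun w hw => mul_nonneg (sub_nonneg.2 (hw0 w hw)) (sq_nonneg _)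
  have expand : ∑ w, (N w0 - N w) * (N w - n * p + σ) ^ 2
      = N w0 * (∑ w, N w ^ 2) + N w0 * (2 * (σ - n * p)) * (∑ w, N w)
        + N w0 * (σ - n * p) ^ 2 * W
        - ∑ w, N w ^ 3 - 2 * (σ - n * p) * (∑ w, N w ^ 2) - (σ - n * p) ^ 2 * ∑ w, N w := by
    have hc : W = ∑ w : Ω, (1 : ℝ) := by simp [hW]
    rw [hc]
    simp only [Finset.mul_sum, ← Finset.sum_add_distrib, ← Finset.sum_sub_distrib]
    exact Finset.sum_congr rfl fun w _ => by ring
  rw [expand, e1, e2, e3] at key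
  have key2 : 0 ≤ (2 * (N w0 - (n * p + σ)) * σ ^ 2 - n * p * (1 - p) * (1 - 2 * p)) * W := by
    refine key.trans (le_of_eq ?_)
    linear_combination (-(N w0 - 2 * σ - n * p)) * W * hσ2
  have key3 := nonneg_of_mul_nonneg_left key2 hWpos
  have h4 : 0 ≤ n * p * (1 - p) * (1 - 2 * p) := mul_nonneg hvar.le (by linarith)
  have h5 : 0 ≤ (N w0 - (n * p + σ)) * σ ^ 2 := by linarith
  have := nonneg_of_mul_nonneg_left h5 (by positivity)
  linarith

lemma fiber_count {A B : Type*} [AddCommGroup A] [Fintype A] [AddCommGroup B] [Fintype B]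
    [DecidableEq B] (φ : A →+ B) (hφ : Function.Surjective φ) (b : B) :
    ∑ a, (if φ a = b then (1 : ℝ) else 0) = (Fintype.card A : ℝ) / Fintype.card B := by
  classical
  have h : ∀ b', ∑ a, (if φ a = b' then (1 : ℝ) else 0) = ∑ a, (if φ a = b then (1 : ℝ) else 0) := by
    intro b'
    obtain ⟨d, hd⟩ := hφ (b - b')
    rw [← Equiv.sum_comp (Equiv.addRight d) (fun a => if φ a = b then (1 : ℝ) else 0)]
    refine Finset.sum_congr rfl fun a _ => ?_
    simp only [Equiv.coe_addRight, map_add, hd]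
    congr 1
    apply propext
    constructor
    · rintro rfl; abel
    · intro h; 
      have : φ a + (b - b') - (b - b') = b - (b - b') := by rw [h]
      simpa using this
  have h2 : ∑ b', ∑ a, (if φ a = b' then (1 : ℝ) else 0) = Fintype.card A := by
    rw [Finset.sum_comm]; simp
  simp only [h, Finset.sum_const, Finset.card_univ, nsmul_eq_mul] at h2
  have : (Fintype.card B : ℝ) ≠ 0 := by
    have : Nonempty B := ⟨0⟩
    exact_mod_cast Fintype.card_ne_zero
  field_simp
  linarith

lemma sum_pi_prod {A : Type*} [Fintype A] (t : ℕ) (h : Fin t → A → ℝ) :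
    ∑ c : Fin t → A, ∏ i, h i (c i) = ∏ i, ∑ a, h i a := by
  classical
  rw [Finset.prod_univ_sum, Fintype.piFinset_univ]

lemma cover {ι : Type*} [Fintype ι] [Nonempty ι] (A : AddSubgroup (ι → ZMod 2))
    (hone : (fun _ => 1) ∈ A)
    (hsep : ∀ x y z, x ≠ y → x ≠ z → ∃ l ∈ A, l x = 1 ∧ l y = 0 ∧ l z = 0)
    (t : ℕ) (ht : 1 ≤ t) (v : Fin t → ι → ZMod 2) :
    ∃ c : Fin t → ι → ZMod 2, (∀ i, c i ∈ A) ∧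
      (genCovDist v c : ℝ) ≤ Fintype.card ι - (Fintype.card ι * (1 / 2 ^ t)
        + √(Fintype.card ι * (1 / 2 ^ t) * (1 - 1 / 2 ^ t))) := by
  classical
  let ev : ι → A →+ ZMod 2 := fun x => (Pi.evalAddMonoidHom (fun _ => ZMod 2) x).comp A.subtype
  have hev : ∀ x (a : A), ev x a = (a : ι → ZMod 2) x := fun _ _ => rfl
  let δ : ι → Fin t → A → ℝ := fun x i a => if (a : ι → ZMod 2) x = v i x then 1 else 0
  let I : ι → (Fin t → A) → ℝ := fun x c => ∏ i, δ x i (c i)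
  have c1 : ∀ x i, ∑ a, δ x i a = (Fintype.card A : ℝ) / 2 := by
    intro x i
    have := fiber_count (ev x) (fun b => ?_) (v i x)
    · rw [ZMod.card] at this
      rw [Nat.cast_ofNat] at this
      exact this
    · rcases zmod2_cases b with rfl | rfl
      · exact ⟨0, map_zero _⟩
      · exact ⟨⟨_, hone⟩, rfl⟩
  have c2 : ∀ x y i, x ≠ y → ∑ a, δ x i a * δ y i a = (Fintype.card A : ℝ) / 4 := by
    intro x y i hxy
    obtain ⟨l, hl, l1, l2, -⟩ := hsep x y y hxy hxy
    obtain ⟨k, hk, k1, k2, -⟩ := hsep y x x hxy.symm hxy.symm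
    have := fiber_count ((ev x).prod (ev y)) (fun b => ?_) (v i x, v i y)
    · rw [Fintype.card_prod, ZMod.card] at this
      norm_num at this
      rw [← this, Finset.card_filter]
      push_cast
      refine Finset.sum_congr rfl fun a _ => ?_
      simp only [δ, hev]
      split_ifs <;> simp_all
    · obtain ⟨b1, b2⟩ := b
      refine ⟨b1.val • ⟨l, hl⟩ + b2.val • ⟨k, hk⟩, ?_⟩
      rcases zmod2_cases b1 with rfl | rfl <;> rcases zmod2_cases b2 with rfl | rfl <;>
        simp [hev, l1, l2, k1, k2, ZMod.val_one]
  have c3 : ∀ x y z i, x ≠ y → x ≠ z → y ≠ z →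
      ∑ a, δ x i a * δ y i a * δ z i a = (Fintype.card A : ℝ) / 8 := by
    intro x y z i hxy hxz hyz
    obtain ⟨l, hl, l1, l2, l3⟩ := hsep x y z hxy hxz
    obtain ⟨k, hk, k1, k2, k3⟩ := hsep y x z hxy.symm hyz
    obtain ⟨j, hj, j1, j2, j3⟩ := hsep z x y hxz.symm hyz.symm
    have := fiber_count (((ev x).prod (ev y)).prod (ev z)) (fun b => ?_) ((v i x, v i y), v i z)
    · rw [Fintype.card_prod, Fintype.card_prod, ZMod.card] at this
      norm_num at this
      rw [← this, Finset.card_filter]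
      push_cast
      refine Finset.sum_congr rfl fun a _ => ?_
      simp only [δ, hev]
      split_ifs <;> simp_all
    · obtain ⟨⟨b1, b2⟩, b3⟩ := b
      refine ⟨b1.val • ⟨l, hl⟩ + b2.val • ⟨k, hk⟩ + b3.val • ⟨j, hj⟩, ?_⟩
      rcases zmod2_cases b1 with rfl | rfl <;> rcases zmod2_cases b2 with rfl | rfl <;>
        rcases zmod2_cases b3 with rfl | rfl <;>
        simp [hev, l1, l2, l3, k1, k2, k3, j1, j2, j3, ZMod.val_one]
  have hδ : ∀ x i a, δ x i a * δ x i a = δ x i a := by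
    intro x i a; simp [δ]
  have hp2 : (1 : ℝ) / 2 ^ t ≤ 1 / 2 := by
    apply one_div_le_one_div_of_le (by norm_num)
    calc (2 : ℝ) = 2 ^ 1 := by norm_num
      _ ≤ 2 ^ t := pow_le_pow_right₀ (by norm_num) ht
  have hcard : (Fintype.card (Fin t → A) : ℝ) = (Fintype.card A : ℝ) ^ t := by simp
  obtain ⟨c, hc⟩ := moment I (fun x w => by simp only [I, ← Finset.prod_mul_distrib, hδ])
    (1 / 2 ^ t) (by positivity) hp2
    (fun x => by
      simp only [I, sum_pi_prod, c1, Finset.prod_const, Finset.card_univ, Fintype.card_fin, hcard]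
      rw [div_pow]; ring)
    (fun x y hxy => by
      simp only [I, ← Finset.prod_mul_distrib]
      rw [sum_pi_prod t (fun i a => δ x i a * δ y i a)]
      simp only [c2 x y _ hxy, Finset.prod_const, Finset.card_univ, Fintype.card_fin, hcard]
      rw [show (4 : ℝ) = 2 ^ 2 by norm_num, div_pow, ← pow_mul, mul_comm 2 t, pow_mul]
      ring)
    (fun x y z hxy hxz hyz => by
      simp only [I, ← Finset.prod_mul_distrib]
      rw [sum_pi_prod t (fun i a => δ x i a * δ y i a * δ z i a)]
      simp only [c3 x y z _ hxy hxz hyz, Finset.prod_const, Finset.card_univ, Fintype.card_fin,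
        hcard]
      rw [show (8 : ℝ) = 2 ^ 3 by norm_num, div_pow, ← pow_mul, mul_comm 3 t, pow_mul]
      ring)
  refine ⟨fun i => c i, fun i => (c i).2, ?_⟩
  refine le_trans (le_of_eq ?_) (sub_le_sub_left hc _)
  have : (genCovDist v (fun i => (c i : ι → ZMod 2)) : ℝ)
      = ∑ x, (1 - I x c) := by
    unfold genCovDist tWeight
    rw [Finset.card_filter]
    push_cast
    refine Finset.sum_congr rfl fun x _ => ?_
    by_cases h : ∃ i, (v - fun i => (c i : ι → ZMod 2)) i x ≠ 0
    · rw [if_pos h]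
      obtain ⟨i, hi⟩ := h
      have : I x c = 0 := Finset.prod_eq_zero (Finset.mem_univ i) (by
        simp only [δ]
        rw [if_neg]
        intro h
        apply hi
        simp [h])
      rw [this]; simp
    · rw [if_neg h]
      push Not at h
      have : I x c = 1 := Finset.prod_eq_one fun i _ => by
        simp only [δ]
        rw [if_pos]
        have := h i
        simp [sub_eq_zero] at this
        exact this.symm
      rw [this]; simp
  rw [this]; simp

def RM1 (m : ℕ) : AddSubgroup ((Fin m → ZMod 2) → ZMod 2) where
  carrier := RM 1 m
  zero_mem' := RM_zero_mem 1 m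
  add_mem' := by
    rintro f g ⟨p, hp, hp'⟩ ⟨q, hq, hq'⟩
    exact ⟨p + q, (MvPolynomial.totalDegree_add _ _).trans (max_le hp hq),
      fun x => by simp [hp', hq']⟩
  neg_mem' := by
    rintro f ⟨p, hp, hp'⟩
    exact ⟨-p, by simpa using hp, fun x => by simp [hp']⟩

lemma RM1_one (m : ℕ) : (fun _ => 1) ∈ RM1 m := ⟨1, by simp, by simp⟩

lemma RM1_coord (m : ℕ) (i : Fin m) : (fun x => x i) ∈ RM1 m :=
  ⟨MvPolynomial.X i, by simp, by simp⟩

lemma RM1_const (m : ℕ) (b : ZMod 2) : (fun _ => b) ∈ RM1 m :=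
  ⟨MvPolynomial.C b, by simp, by simp⟩

lemma RM1_sep (m : ℕ) (x y z : Fin m → ZMod 2) (hxy : x ≠ y) (hxz : x ≠ z) :
    ∃ l ∈ RM1 m, l x = 1 ∧ l y = 0 ∧ l z = 0 := by
  have d1 : ∀ a b c : ZMod 2, a ≠ b → a ≠ c → a + b = 1 ∧ b + b = 0 ∧ c + b = 0 := by decide
  have d2 : ∀ a b c a' b' c' : ZMod 2, a ≠ b → ¬ (a ≠ c) → a' ≠ c' → ¬ (a' ≠ b') →
      a + a' + (b + b') = 1 ∧ b + b' + (b + b') = 0 ∧ c + c' + (b + b') = 0 := by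
    intro a b c a' b' c' h1 h2 h3 h4
    rw [not_not] at h2 h4
    subst h2 h4
    revert a b a' c'
    decide
  obtain ⟨i, hi⟩ := Function.ne_iff.1 hxy
  obtain ⟨j, hj⟩ := Function.ne_iff.1 hxz
  by_cases h1 : x i ≠ z i
  · exact ⟨_, (RM1 m).add_mem (RM1_coord m i) (RM1_const m (y i)), d1 _ _ _ hi h1⟩
  by_cases h2 : x j ≠ y j
  · exact ⟨_, (RM1 m).add_mem (RM1_coord m j) (RM1_const m (y j)), d1 _ _ _ h2 hj⟩
  exact ⟨_, (RM1 m).add_mem ((RM1 m).add_mem (RM1_coord m i) (RM1_coord m j))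
    (RM1_const m (y i + y j)), d2 _ _ _ _ _ _ hi h1 hj h2⟩

lemma first_order (m t : ℕ) (ht : 1 ≤ t) :
    (genCovRadius (RM 1 m) t : ℝ) ≤
      (1 - 1 / 2 ^ t) * 2 ^ m - (√(2 ^ t - 1) / 2 ^ t) * √(2 ^ m) := by
  have hb : ∀ v : Fin t → (Fin m → ZMod 2) → ZMod 2, ∃ c : Fin t → (Fin m → ZMod 2) → ZMod 2,
      (∀ i, c i ∈ RM 1 m) ∧ (genCovDist v c : ℝ) ≤
        (1 - 1 / 2 ^ t) * 2 ^ m - (√(2 ^ t - 1) / 2 ^ t) * √(2 ^ m) := by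
    intro v
    obtain ⟨c, hc, hc'⟩ := cover (RM1 m) (RM1_one m) (RM1_sep m) t ht v
    refine ⟨c, hc, hc'.trans (le_of_eq ?_)⟩
    have hcard : (Fintype.card (Fin m → ZMod 2) : ℝ) = 2 ^ m := by simp [ZMod.card]
    rw [hcard]
    have h1 : (1 : ℝ) ≤ 2 ^ t := one_le_pow₀ (by norm_num)
    have : √((2 : ℝ) ^ m * (1 / 2 ^ t) * (1 - 1 / 2 ^ t)) = (√(2 ^ t - 1) / 2 ^ t) * √(2 ^ m) := by
      have e : (2 : ℝ) ^ m * (1 / 2 ^ t) * (1 - 1 / 2 ^ t)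
          = (2 ^ t - 1) * 2 ^ m / (2 ^ t) ^ 2 := by field_simp
      rw [e, Real.sqrt_div' _ (by positivity), Real.sqrt_sq (by positivity),
        Real.sqrt_mul (by linarith)]
      ring
    rw [this]; ring
  have h0 : 0 ≤ (1 - 1 / 2 ^ t) * 2 ^ m - (√(2 ^ t - 1) / 2 ^ t) * √((2 : ℝ) ^ m) := by
    obtain ⟨c, -, hc⟩ := hb 0
    exact (Nat.cast_nonneg _).trans hc
  refine (Nat.cast_le.2 (gcr_le _ t _ fun v => ?_)).trans (Nat.floor_le h0)
  obtain ⟨c, hc, hc'⟩ := hb v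
  exact ⟨c, hc, Nat.le_floor hc'⟩

lemma case_three (t : ℕ) (ht : 1 ≤ t) (R : ℕ)
    (h : (R : ℝ) ≤ (1 - 1 / 2 ^ t) * 2 ^ 3 - (√(2 ^ t - 1) / 2 ^ t) * √(2 ^ 3)) :
    (R : ℝ) ≤ (1 - 1 / 2 ^ t) * 2 ^ 3 - (√(2 ^ t - 1) / 2 ^ t) * (3 : ℕ) := by
  have h8 : (2.82 : ℝ) ≤ √(2 ^ 3) := Real.le_sqrt_of_sq_le (by norm_num)
  have h' : (R : ℝ) ≤ (1 - 1 / 2 ^ t) * 2 ^ 3 - (√(2 ^ t - 1) / 2 ^ t) * 2.82 :=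
    h.trans (sub_le_sub_left (mul_le_mul_of_nonneg_left h8 (by positivity)) _)
  clear h h8
  have up : ∀ k : ℕ, (R : ℝ) < k + 1 → (R : ℝ) ≤ k := by
    intro k hk
    have : R < k + 1 := by exact_mod_cast hk
    exact_mod_cast Nat.lt_succ_iff.1 this
  rcases Nat.lt_or_ge t 5 with h5 | h5
  · interval_cases t
    · norm_num at h' ⊢
      have := up 2 (by push_cast; linarith)
      push_cast at this
      linarith
    · norm_num at h' ⊢
      have l : (1.7 : ℝ) ≤ √3 := Real.le_sqrt_of_sq_le (by norm_num)
      have u : √3 ≤ (1.8 : ℝ) := (Real.sqrt_le_left (by norm_num)).2 (by norm_num)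
      have := up 4 (by push_cast; linarith)
      push_cast at this
      linarith
    · norm_num at h' ⊢
      have l : (2.6 : ℝ) ≤ √7 := Real.le_sqrt_of_sq_le (by norm_num)
      have u : √7 ≤ (2.65 : ℝ) := (Real.sqrt_le_left (by norm_num)).2 (by norm_num)
      have := up 6 (by push_cast; linarith)
      push_cast at this
      linarith
    · norm_num at h' ⊢
      have l : (3.8 : ℝ) ≤ √15 := Real.le_sqrt_of_sq_le (by norm_num)
      have u : √15 ≤ (3.9 : ℝ) := (Real.sqrt_le_left (by norm_num)).2 (by norm_num)
      have := up 6 (by push_cast; linarith)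
      push_cast at this
      linarith
  · have hT : (32 : ℝ) ≤ 2 ^ t := by
      calc (32 : ℝ) = 2 ^ 5 := by norm_num
        _ ≤ 2 ^ t := pow_le_pow_right₀ (by norm_num) h5
    generalize (2 : ℝ) ^ t = T at hT h' ⊢
    have hTpos : 0 < T := by linarith
    have hs : √(T - 1) ≤ (T - 8) / 3 := (Real.sqrt_le_left (by linarith)).2 (by nlinarith)
    have h7 := up 7 (by
      have a : 0 < 1 / T := by positivity
      have b : 0 ≤ √(T - 1) / T := by positivity
      push_cast
      linarith)
    refine h7.trans ?_
    have : (√(T - 1) / T) * 3 ≤ 1 - 8 * (1 / T) := by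
      have e : 1 - 8 * (1 / T) = (T - 8) / 3 / T * 3 := by field_simp
      rw [e]
      gcongr
    push_cast
    linarith

lemma first_order' (m t : ℕ) (ht : 1 ≤ t) :
    (genCovRadius (RM 1 m) t : ℝ) ≤
      (1 - 1 / 2 ^ t) * 2 ^ m - (√(2 ^ t - 1) / 2 ^ t) * m := by
  have h := first_order m t ht
  by_cases hm : m = 3
  · subst hm
    generalize genCovRadius (RM 1 3) t = R at h ⊢
    exact case_three t ht R h
  · refine h.trans (sub_le_sub_left (mul_le_mul_of_nonneg_left ?_ (by positivity)) _)
    apply Real.le_sqrt_of_sq_le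
    have : m ^ 2 ≤ 2 ^ m := by
      rcases lt_or_ge m 4 with h4 | h4
      · interval_cases m <;> simp_all
      · clear h hm
        induction m, h4 using Nat.le_induction with
        | base => norm_num
        | succ k hk ih => rw [pow_succ 2 k]; nlinarith
    exact_mod_cast this

lemma main_pos (t : ℕ) (ht : 1 ≤ t) (m : ℕ) : ∀ r, 1 ≤ r → r ≤ m →
    (genCovRadius (RM r m) t : ℝ) ≤
      (1 - 1 / 2 ^ t) * 2 ^ m - (Real.sqrt (2 ^ t - 1) / 2 ^ t) * (m.choose r : ℝ) := by
  induction m with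
  | zero => intro r h1 h2; omega
  | succ m ih =>
    intro r h1 h2
    obtain ⟨r, rfl⟩ : ∃ k, r = k + 1 := ⟨r - 1, by omega⟩
    rcases Nat.eq_zero_or_pos r with rfl | hr
    · simpa using first_order' (m + 1) t ht
    rcases Nat.lt_or_ge r m with hrm | hrm
    · have a := ih r hr hrm.le
      have b := ih (r + 1) h1 hrm
      have c : (genCovRadius (RM (r + 1) (m + 1)) t : ℝ) ≤
        genCovRadius (RM r m) t + genCovRadius (RM (r + 1) m) t := by exact_mod_cast gcr_rec r m t
      rw [Nat.choose_succ_succ, pow_succ]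
      push_cast
      linarith
    · have : r = m := by omega
      subst this
      have h0 : genCovRadius (RM (r + 1) (r + 1)) t ≤ 0 :=
        gcr_le _ _ _ fun v => ⟨v, fun i => RM_full _ _, by simp [genCovDist, tWeight]⟩
      rw [Nat.le_zero.1 h0]
      have hT : (2 : ℝ) ≤ 2 ^ t := by
        calc (2 : ℝ) = 2 ^ 1 := by norm_num
          _ ≤ 2 ^ t := pow_le_pow_right₀ (by norm_num) ht
      have hm : (1 : ℝ) ≤ 2 ^ (r + 1) := one_le_pow₀ (by norm_num)
      have hs : √((2 : ℝ) ^ t - 1) ≤ 2 ^ t - 1 := by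
        rw [Real.sqrt_le_left (by linarith)]
        nlinarith
      have e : (1 - 1 / (2 : ℝ) ^ t) = (2 ^ t - 1) / 2 ^ t := by field_simp
      rw [e]
      have h3 : √((2 : ℝ) ^ t - 1) / 2 ^ t ≤ (2 ^ t - 1) / 2 ^ t := by gcongr
      have h4 : 0 ≤ ((2 : ℝ) ^ t - 1) / 2 ^ t := div_nonneg (by linarith) (by positivity)
      simp only [Nat.choose_self, Nat.cast_one, Nat.cast_zero]
      nlinarith

/-- R_t(r,m) ≤ (1 − 1/2^t)·2^m − (√(2^t − 1)/2^t)·C(m,r) for 1 ≤ r ≤ m. -/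
theorem stmt13 (m t r : ℕ) (hr1 : 1 ≤ r) (hrm : r ≤ m) :
    (genCovRadius (RM r m) t : ℝ) ≤
      (1 - 1 / 2 ^ t) * 2 ^ m - (Real.sqrt (2 ^ t - 1) / 2 ^ t) * (m.choose r : ℝ) := by
  rcases Nat.eq_zero_or_pos t with rfl | ht
  · have h0 : genCovRadius (RM r m) 0 ≤ 0 :=
      gcr_le _ _ _ fun v => ⟨v, fun i => i.elim0, by simp [genCovDist, tWeight]⟩
    rw [Nat.le_zero.1 h0]; simp
  · exact main_pos t ht m r hr1 hrm
end

section
/- For all m, t ∈ ℕ with m ≥ 3 and all integers 2 ≤ r ≤ m/(2+√2), the t-th generalized covering radius of RM(r,m) satisfies R_t(r,m) ≤ (1 − 1/2^t)·2^m − (√(2^t−1)/2^t)·(1+√2)^{r−1}·2^{(m−1)/2} + (√(2^t−1)/(2^t·2^{1/4}))·r·C(m,r). -/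
/-- Every `t`-tuple of words is within `t`-distance `B` of the code `RM r m`. -/
def Cov (r m t : ℕ) (B : ℝ) : Prop :=
  ∀ v : Fin t → (Fin m → ZMod 2) → ZMod 2, ∃ c : Fin t → (Fin m → ZMod 2) → ZMod 2,
    (∀ i, c i ∈ RM r m) ∧ (genCovDist v c : ℝ) ≤ B

lemma Cov.radius_le {r m t : ℕ} {B : ℝ} (h : Cov r m t B) : (genCovRadius (RM r m) t : ℝ) ≤ B := by
  have hB : 0 ≤ B := by
    obtain ⟨c, -, hc⟩ := h (fun _ _ => 0)
    exact le_trans (Nat.cast_nonneg _) hc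
  have : genCovRadius (RM r m) t ≤ ⌊B⌋₊ := by
    apply Nat.sInf_le
    intro v
    obtain ⟨c, h1, h2⟩ := h v
    exact ⟨c, h1, Nat.le_floor h2⟩
  exact le_trans (Nat.cast_le.mpr this) (Nat.floor_le hB)

lemma Cov.mono {r r' m t : ℕ} {B B' : ℝ} (h : Cov r m t B) (hr : r ≤ r') (hB : B ≤ B') :
    Cov r' m t B' := by
  intro v
  obtain ⟨c, h1, h2⟩ := h v
  refine ⟨c, fun i => ?_, h2.trans hB⟩
  obtain ⟨p, hp, hp'⟩ := h1 i
  exact ⟨p, hp.trans hr, hp'⟩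

lemma tWeight_eq_sum {ι F : Type*} [Fintype ι] [Zero F] {t : ℕ} (v : Fin t → ι → F) :
    tWeight v = ∑ j : ι, open Classical in if ∃ i, v i j ≠ 0 then 1 else 0 := by
  classical
  unfold tWeight
  rw [Finset.card_filter]

lemma sum_split {m : ℕ} (f : (Fin (m+1) → ZMod 2) → ℕ) :
    ∑ x, f x = ∑ y : Fin m → ZMod 2, f (Fin.cons 0 y) + ∑ y : Fin m → ZMod 2, f (Fin.cons 1 y) := by
  rw [← (Fin.consEquiv (fun _ : Fin (m+1) => ZMod 2)).sum_comp, Fintype.sum_prod_type]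
  have : ∀ g : ZMod 2 → ℕ, ∑ x, g x = g 0 + g 1 := fun g => Fin.sum_univ_two g
  rw [this]
  rfl

lemma Cov.step {r m t : ℕ} {B1 B2 : ℝ} (h1 : Cov r m t B1) (h2 : Cov (r+1) m t B2) :
    Cov (r+1) (m+1) t (B1 + B2) := by
  intro v
  obtain ⟨u, hu, hu'⟩ := h2 (fun i y => v i (Fin.cons 0 y))
  obtain ⟨w, hw, hw'⟩ := h1 (fun i y => v i (Fin.cons 1 y) - u i y)
  refine ⟨fun i x => u i (Fin.tail x) + x 0 * w i (Fin.tail x), fun i => ?_, ?_⟩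
  · obtain ⟨p, hp, hp'⟩ := hu i
    obtain ⟨q, hq, hq'⟩ := hw i
    refine ⟨MvPolynomial.rename Fin.succ p + MvPolynomial.X 0 * MvPolynomial.rename Fin.succ q,
      ?_, fun x => ?_⟩
    · refine (MvPolynomial.totalDegree_add _ _).trans (max_le ?_ ?_)
      · exact (MvPolynomial.totalDegree_rename_le _ _).trans hp
      · refine (MvPolynomial.totalDegree_mul _ _).trans ?_
        have := (MvPolynomial.totalDegree_rename_le (Fin.succ : Fin m → Fin (m+1)) q).trans hq
        rw [MvPolynomial.totalDegree_X]
        omega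
    · simp only [map_add, map_mul, MvPolynomial.eval_rename, MvPolynomial.eval_X]
      rw [← hp', ← hq']
      rfl
  · have : genCovDist v (fun i x => u i (Fin.tail x) + x 0 * w i (Fin.tail x))
        = genCovDist (fun i y => v i (Fin.cons 0 y)) u
          + genCovDist (fun i y => v i (Fin.cons 1 y) - u i y) w := by
      unfold genCovDist
      rw [tWeight_eq_sum, tWeight_eq_sum, tWeight_eq_sum, sum_split]
      congr 1
      · refine Finset.sum_congr rfl fun y _ => ?_
        simp only [Pi.sub_apply, Fin.tail_cons, Fin.cons_zero, zero_mul, add_zero]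
        congr
      · refine Finset.sum_congr rfl fun y _ => ?_
        simp only [Pi.sub_apply, Fin.tail_cons, Fin.cons_zero, one_mul, sub_sub]
    rw [this]
    push_cast
    linarith

lemma Cov.full (m t : ℕ) : Cov m m t 0 := by
  induction m with
  | zero =>
    intro v
    refine ⟨v, fun i => ⟨MvPolynomial.C (v i 0), by simp, fun x => ?_⟩, ?_⟩
    · rw [MvPolynomial.eval_C, Subsingleton.elim x 0]
    · simp [genCovDist, tWeight]
  | succ m ih =>
    have := ih.step (ih.mono (Nat.le_succ m) le_rfl)
    simpa using this

lemma exists_affine {m : ℕ} {x y z : Fin m → ZMod 2} (hy : x ≠ y) (hz : x ≠ z) :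
    ∃ (g0 : ZMod 2) (g : Fin m → ZMod 2),
      g0 + x ⬝ᵥ g = 1 ∧ g0 + y ⬝ᵥ g = 0 ∧ g0 + z ⬝ᵥ g = 0 := by
  have key : ∀ a b c : ZMod 2, a ≠ b → a ≠ c → b = c := by decide
  have one : ∀ a b : ZMod 2, a ≠ b → -b + a = 1 := by decide
  obtain ⟨j, hj⟩ := Function.ne_iff.mp hy
  obtain ⟨k, hk⟩ := Function.ne_iff.mp hz
  by_cases h1 : x j = z j
  · by_cases h2 : x k = y k
    · refine ⟨-(y j + y k), Pi.single j 1 + Pi.single k 1, ?_⟩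
      simp only [dotProduct_add, dotProduct_single, mul_one]
      generalize x j = a at *
      generalize x k = b at *
      generalize y j = c at *
      generalize y k = d at *
      generalize z j = e at *
      generalize z k = f at *
      clear key one
      revert a b c d e f
      decide
    · refine ⟨-(y k), Pi.single k 1, ?_⟩
      simp only [dotProduct_single, mul_one]
      have := key _ _ _ h2 hk
      rw [← this]
      exact ⟨one _ _ h2, by ring, by ring⟩
  · refine ⟨-(y j), Pi.single j 1, ?_⟩
    simp only [dotProduct_single, mul_one]
    have := key _ _ _ hj h1
    rw [← this]
    exact ⟨one _ _ hj, by ring, by ring⟩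

abbrev Om (m t : ℕ) := (Fin t → ZMod 2) × (Fin t → Fin m → ZMod 2)

def ev {m t : ℕ} (x : Fin m → ZMod 2) (w : Om m t) : Fin t → ZMod 2 :=
  fun i => w.1 i + x ⬝ᵥ w.2 i

lemma ev_mem {m t : ℕ} (w : Om m t) (i : Fin t) : (fun x => ev x w i) ∈ RM 1 m := by
  refine ⟨MvPolynomial.C (w.1 i) + ∑ j, MvPolynomial.X j * MvPolynomial.C (w.2 i j), ?_, ?_⟩
  · refine (MvPolynomial.totalDegree_add _ _).trans (max_le (by simp) ?_)
    refine MvPolynomial.totalDegree_finsetSum_le (fun j _ => ?_)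
    refine (MvPolynomial.totalDegree_mul _ _).trans ?_
    simp
  · intro x
    simp [ev, dotProduct]

/-- centred indicator of agreement -/
noncomputable def xi {m t : ℕ} (v : (Fin m → ZMod 2) → (Fin t → ZMod 2)) (x : Fin m → ZMod 2)
    (w : Om m t) : ℝ := (if ev x w = v x then 1 else 0) - 1 / 2 ^ t

lemma sum_xi_mul {m t : ℕ} (v : (Fin m → ZMod 2) → (Fin t → ZMod 2)) {x y z : Fin m → ZMod 2}
    (hy : x ≠ y) (hz : x ≠ z) (F : (Fin t → ZMod 2) → (Fin t → ZMod 2) → ℝ) :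
    ∑ w : Om m t, xi v x w * F (ev y w) (ev z w) = 0 := by
  obtain ⟨g0, g, hx1, hy0, hz0⟩ := exists_affine hy hz
  let s : (Fin t → ZMod 2) → Om m t := fun a => (fun i => a i * g0, fun i => a i • g)
  have hs : ∀ a x w, ev x (w + s a) = fun i => ev x w i + a i * (g0 + x ⬝ᵥ g) := by
    intro a x w
    funext i
    simp [ev, s, dotProduct_add, dotProduct_smul]
    ring
  have h1 : ∀ a, ∑ w : Om m t, xi v x w * F (ev y w) (ev z w)
      = ∑ w : Om m t, ((if ev x w + a = v x then 1 else 0) - 1 / 2 ^ t) * F (ev y w) (ev z w) := by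
    intro a
    rw [← Equiv.sum_comp (Equiv.addRight (s a))]
    refine Finset.sum_congr rfl fun w _ => ?_
    simp only [Equiv.coe_addRight, xi, hs, hx1, hy0, hz0, mul_one, mul_zero, add_zero]
    rfl
  have h2 : ∑ a : Fin t → ZMod 2, ∑ w : Om m t, xi v x w * F (ev y w) (ev z w) = 0 := by
    rw [Finset.sum_congr rfl (fun a _ => h1 a), Finset.sum_comm]
    refine Finset.sum_eq_zero fun w _ => ?_
    rw [← Finset.sum_mul]
    have : ∑ a : Fin t → ZMod 2, ((if ev x w + a = v x then (1:ℝ) else 0) - 1 / 2 ^ t) = 0 := by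
      rw [Finset.sum_sub_distrib]
      have : ∀ a, (ev x w + a = v x) ↔ (a = v x - ev x w) := fun a => by
        rw [eq_sub_iff_add_eq, add_comm]
      simp [this]
    rw [this, zero_mul]
  rw [Finset.sum_const, nsmul_eq_mul] at h2
  have : ((Finset.univ : Finset (Fin t → ZMod 2)).card : ℝ) ≠ 0 := by simp
  exact (mul_eq_zero.mp h2).resolve_left this

lemma xi_sq {m t : ℕ} (v : (Fin m → ZMod 2) → (Fin t → ZMod 2)) (x : Fin m → ZMod 2) (w : Om m t) :
    xi v x w * xi v x w = (1 - 2 * (1 / 2 ^ t)) * xi v x w + 1 / 2 ^ t * (1 - 1 / 2 ^ t) := by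
  unfold xi
  split_ifs <;> ring

section moments
variable {m t : ℕ} (v : (Fin (m+1) → ZMod 2) → (Fin t → ZMod 2))

lemma sum_xi (x : Fin (m+1) → ZMod 2) : ∑ w, xi v x w = 0 := by
  obtain ⟨y, hy⟩ := exists_ne x
  simpa using sum_xi_mul v hy.symm hy.symm (fun _ _ => 1)

/-- `xi` as a function of the evaluation -/
lemma xi_fac (x : Fin (m+1) → ZMod 2) : ∃ F : (Fin t → ZMod 2) → ℝ, ∀ w, xi v x w = F (ev x w) :=
  ⟨fun a => (if a = v x then 1 else 0) - 1 / 2 ^ t, fun _ => rfl⟩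

lemma sum_xi2 (x y : Fin (m+1) → ZMod 2) : ∑ w, xi v x w * xi v y w
    = if x = y then (Fintype.card (Om (m+1) t) : ℝ) * (1 / 2 ^ t * (1 - 1 / 2 ^ t)) else 0 := by
  split_ifs with h
  · subst h
    simp_rw [xi_sq]
    rw [Finset.sum_add_distrib, ← Finset.mul_sum, sum_xi, Finset.sum_const, nsmul_eq_mul,
      Finset.card_univ]
    ring
  · obtain ⟨F, hF⟩ := xi_fac v y
    simp_rw [hF]
    exact sum_xi_mul v h h (fun a _ => F a)

lemma sum_xi3 (x y z : Fin (m+1) → ZMod 2) : ∑ w, xi v x w * xi v y w * xi v z w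
    = if x = y then if y = z then (Fintype.card (Om (m+1) t) : ℝ) *
        ((1 - 2 * (1 / 2 ^ t)) * (1 / 2 ^ t * (1 - 1 / 2 ^ t))) else 0 else 0 := by
  have main : ∀ x y z : Fin (m+1) → ZMod 2, x ≠ y → x ≠ z →
      ∑ w, xi v x w * xi v y w * xi v z w = 0 := by
    intro x y z h1 h2
    obtain ⟨F, hF⟩ := xi_fac v y
    obtain ⟨G, hG⟩ := xi_fac v z
    simp_rw [hF, hG, mul_assoc]
    exact sum_xi_mul v h1 h2 (fun a b => F a * G b)
  split_ifs with h1 h2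
  · subst h1 h2
    simp_rw [xi_sq, add_mul, mul_assoc, xi_sq]
    simp only [Finset.sum_add_distrib, ← Finset.mul_sum, sum_xi, Finset.sum_const, nsmul_eq_mul,
      Finset.card_univ]
    ring
  · subst h1
    rw [← main z x x (Ne.symm h2) (Ne.symm h2)]
    exact Finset.sum_congr rfl fun w _ => by ring
  · by_cases h3 : x = z
    · subst h3
      rw [← main y x x (Ne.symm h1) (Ne.symm h1)]
      exact Finset.sum_congr rfl fun w _ => by ring
    · exact main x y z h1 h3

lemma exists_good (ht : 1 ≤ t) : ∃ w : Om (m+1) t,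
    Real.sqrt (2 ^ (m+1) * (1 / 2 ^ t * (1 - 1 / 2 ^ t))) ≤ ∑ x, xi v x w := by
  set q : ℝ := 1 / 2 ^ t with hq
  have hq0 : 0 < q := by positivity
  have hq1 : q ≤ 1 / 2 := by
    rw [hq]
    apply one_div_le_one_div_of_le (by norm_num)
    calc (2:ℝ) = 2 ^ 1 := by norm_num
      _ ≤ 2 ^ t := pow_le_pow_right₀ (by norm_num) ht
  set σ := Real.sqrt (2 ^ (m+1) * (q * (1 - q))) with hσ
  have hσ2 : σ ^ 2 = 2 ^ (m+1) * (q * (1 - q)) :=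
    Real.sq_sqrt (mul_nonneg (by positivity) (mul_nonneg hq0.le (by linarith)))
  have hσ0 : 0 < σ := Real.sqrt_pos.mpr (mul_pos (by positivity) (mul_pos hq0 (by linarith)))
  set X : Om (m+1) t → ℝ := fun w => ∑ x, xi v x w with hX
  have cardpos : (0:ℝ) < Fintype.card (Om (m+1) t) := by exact_mod_cast Fintype.card_pos
  have m1 : ∑ w, X w = 0 := by
    rw [hX, Finset.sum_comm]
    exact Finset.sum_eq_zero fun x _ => sum_xi v x
  have m2 : ∑ w, X w ^ 2 = Fintype.card (Om (m+1) t) * σ ^ 2 := by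
    have : ∀ w, X w ^ 2 = ∑ x, ∑ y, xi v x w * xi v y w := fun w => by
      rw [sq, hX, Finset.sum_mul_sum]
    simp_rw [this]
    rw [Finset.sum_comm]
    simp_rw [Finset.sum_comm (s := (Finset.univ : Finset (Om (m+1) t))), sum_xi2]
    simp [hσ2, ← hq]
    ring
  have m3 : 0 ≤ ∑ w, X w ^ 3 := by
    have : ∀ w, X w ^ 3 = ∑ x, ∑ y, ∑ z, xi v x w * xi v y w * xi v z w := fun w => by
      rw [pow_succ, sq, hX]
      dsimp only
      rw [Finset.sum_mul_sum, Finset.sum_mul]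
      refine Finset.sum_congr rfl fun x _ => ?_
      rw [Finset.sum_mul]
      exact Finset.sum_congr rfl fun y _ => Finset.mul_sum _ _ _
    simp_rw [this]
    rw [Finset.sum_comm]
    refine Finset.sum_nonneg fun x _ => ?_
    rw [Finset.sum_comm]
    refine Finset.sum_nonneg fun y _ => ?_
    rw [Finset.sum_comm]
    refine Finset.sum_nonneg fun z _ => ?_
    rw [sum_xi3, ← hq]
    have : 0 ≤ (Fintype.card (Om (m+1) t) : ℝ) * ((1 - 2 * q) * (q * (1 - q))) :=
      mul_nonneg cardpos.le (mul_nonneg (by linarith) (mul_nonneg hq0.le (by linarith)))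
    split_ifs <;> first | exact this | exact le_rfl
  by_contra hcon
  push Not at hcon
  have e : ∑ w, (σ - X w) * (X w + σ) ^ 2 = - ∑ w, X w ^ 3 := by
    have : ∀ w, (σ - X w) * (X w + σ) ^ 2 = σ ^ 3 + σ ^ 2 * X w - σ * X w ^ 2 - X w ^ 3 :=
      fun w => by ring
    simp_rw [this]
    rw [Finset.sum_sub_distrib, Finset.sum_sub_distrib, Finset.sum_add_distrib, ← Finset.mul_sum,
      ← Finset.mul_sum, m1, m2, Finset.sum_const, nsmul_eq_mul, Finset.card_univ]
    ring
  have nn : ∀ w ∈ (Finset.univ : Finset (Om (m+1) t)), 0 ≤ (σ - X w) * (X w + σ) ^ 2 :=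
    fun w _ => mul_nonneg (by linarith [hcon w]) (sq_nonneg _)
  have z : ∑ w, (σ - X w) * (X w + σ) ^ 2 = 0 :=
    le_antisymm (by rw [e]; linarith) (Finset.sum_nonneg nn)
  rw [Finset.sum_eq_zero_iff_of_nonneg nn] at z
  have hXs : ∀ w, X w = -σ := fun w => by
    have h1 := (mul_eq_zero.mp (z w (Finset.mem_univ _))).resolve_left (by linarith [hcon w])
    have := pow_eq_zero_iff (two_ne_zero) |>.mp h1
    linarith
  simp_rw [hXs] at m1
  rw [Finset.sum_const, nsmul_eq_mul, Finset.card_univ] at m1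
  have : (Fintype.card (Om (m+1) t) : ℝ) * σ > 0 := mul_pos cardpos hσ0
  linarith

end moments

lemma sqrt_form (m t : ℕ) :
    Real.sqrt (2 ^ m * (1 / 2 ^ t * (1 - 1 / 2 ^ t)))
      = Real.sqrt (2 ^ t - 1) / 2 ^ t * Real.sqrt 2 ^ m := by
  have h1 : (1:ℝ) ≤ 2 ^ t := one_le_pow₀ (by norm_num)
  have h2 : (2:ℝ) ^ t ≠ 0 := by positivity
  have h3 : (2:ℝ) ^ m * (1 / 2 ^ t * (1 - 1 / 2 ^ t))
      = (Real.sqrt (2 ^ t - 1) / 2 ^ t * Real.sqrt 2 ^ m) ^ 2 := by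
    rw [mul_pow, div_pow, Real.sq_sqrt (by linarith), pow_right_comm (Real.sqrt 2),
      Real.sq_sqrt (by norm_num)]
    field_simp
  rw [h3, Real.sqrt_sq (by positivity)]

lemma Cov.first (m t : ℕ) (ht : 1 ≤ t) : Cov 1 (m+1) t
    ((1 - 1 / 2 ^ t) * 2 ^ (m+1) - Real.sqrt (2 ^ t - 1) / 2 ^ t * Real.sqrt 2 ^ (m+1)) := by
  intro v
  obtain ⟨w, hw⟩ := exists_good (fun x i => v i x) ht
  refine ⟨fun i x => ev x w i, fun i => ev_mem w i, ?_⟩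
  rw [sqrt_form] at hw
  have : (genCovDist v (fun i x => ev x w i) : ℝ) + ∑ x, xi (fun x i => v i x) x w
      = (1 - 1 / 2 ^ t) * 2 ^ (m+1) := by
    unfold genCovDist
    rw [tWeight_eq_sum]
    push_cast
    rw [← Finset.sum_add_distrib]
    have : ∀ x : Fin (m+1) → ZMod 2,
        ((if ∃ i, (v - fun i x => ev x w i) i x ≠ 0 then (1:ℝ) else 0)
          + xi (fun x i => v i x) x w) = 1 - 1 / 2 ^ t := by
      intro x
      have h : (∃ i, (v - fun i x => ev x w i) i x ≠ 0) ↔ ¬ (ev x w = fun i => v i x) := by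
        rw [funext_iff, not_forall]
        simp only [Pi.sub_apply, ne_eq, sub_eq_zero]
        simp only [eq_comm]
      unfold xi
      by_cases h' : ev x w = fun i => v i x
      · simp [h']
      · rw [if_pos (h.mpr h'), if_neg h']
        ring
    convert Finset.sum_congr rfl (fun x _ => this x) using 1
    simp
    ring
  linarith

/-- error sum -/
noncomputable def Herr (R M : ℕ) : ℝ :=
  ∑ j ∈ Finset.range R, (M.choose j : ℝ) * (1 + Real.sqrt 2) ^ (R - j)

lemma Herr_step (R M : ℕ) : Herr (R+1) (M+1) = Herr R M + Herr (R+1) M := by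
  unfold Herr
  rw [Finset.sum_range_succ', Finset.sum_range_succ' _ R]
  simp only [Nat.choose_succ_succ, Nat.choose_zero_right, Nat.add_sub_add_right]
  push_cast
  simp only [add_mul, Finset.sum_add_distrib]
  ring

lemma Herr_diag (M : ℕ) : Herr (M+1) M = (1 + Real.sqrt 2) ^ (M+1) * Real.sqrt 2 ^ M := by
  have h2 : Real.sqrt 2 * Real.sqrt 2 = 2 := Real.mul_self_sqrt (by norm_num)
  have : (1 + Real.sqrt 2) ^ (M+1) * Real.sqrt 2 ^ M
      = (1 + Real.sqrt 2) * (1 + (1 + Real.sqrt 2)) ^ M := by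
    have : 1 + (1 + Real.sqrt 2) = (1 + Real.sqrt 2) * Real.sqrt 2 := by linarith
    rw [this, mul_pow]
    ring
  rw [this, add_pow, Finset.mul_sum]
  unfold Herr
  refine Finset.sum_congr rfl fun j hj => ?_
  have : M + 1 - j = (M - j) + 1 := by have := Finset.mem_range.mp hj; omega
  rw [this, pow_succ]
  ring

lemma Cov.main (t : ℕ) (ht : 1 ≤ t) (M : ℕ) : ∀ R ≤ M + 1, Cov (R+1) (M+2) t
    ((1 - 1 / 2 ^ t) * 2 ^ (M+2) - Real.sqrt (2 ^ t - 1) / 2 ^ t *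
      (2 * ((1 + Real.sqrt 2) ^ R * Real.sqrt 2 ^ M - Herr R M))) := by
  have h2 : Real.sqrt 2 * Real.sqrt 2 = 2 := Real.mul_self_sqrt (by norm_num)
  have hS : 0 ≤ 1 - 1 / (2:ℝ) ^ t := by
    have h1 : (1:ℝ) ≤ 2 ^ t := one_le_pow₀ (by norm_num)
    have := (div_le_one (by positivity)).mpr h1
    linarith
  have base : ∀ M, Cov (0+1) (M+2) t
    ((1 - 1 / 2 ^ t) * 2 ^ (M+2) - Real.sqrt (2 ^ t - 1) / 2 ^ t *
      (2 * ((1 + Real.sqrt 2) ^ 0 * Real.sqrt 2 ^ M - Herr 0 M))) := by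
    intro M
    refine (Cov.first (M+1) t ht).mono le_rfl (le_of_eq ?_)
    have : Real.sqrt 2 ^ (M+1+1) = 2 * Real.sqrt 2 ^ M := by
      rw [pow_succ, pow_succ, mul_assoc, h2, mul_comm]
    simp [Herr, this]
  have diag : ∀ M, Cov (M+1+1) (M+2) t
    ((1 - 1 / 2 ^ t) * 2 ^ (M+2) - Real.sqrt (2 ^ t - 1) / 2 ^ t *
      (2 * ((1 + Real.sqrt 2) ^ (M+1) * Real.sqrt 2 ^ M - Herr (M+1) M))) := by
    intro M
    refine (Cov.full (M+2) t).mono le_rfl ?_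
    rw [Herr_diag, sub_self, mul_zero, mul_zero, sub_zero]
    positivity
  induction M with
  | zero =>
    intro R hR
    interval_cases R
    · exact base 0
    · exact diag 0
  | succ M ih =>
    intro R hR
    rcases R with _ | R
    · exact base (M+1)
    · rcases Nat.lt_or_ge R (M+1) with hlt | hge
      · refine ((ih R (by omega)).step (ih (R+1) (by omega))).mono le_rfl (le_of_eq ?_)
        rw [Herr_step]
        have : (1 + Real.sqrt 2) ^ (R+1) * Real.sqrt 2 ^ (M+1)
            = (1 + Real.sqrt 2) ^ R * Real.sqrt 2 ^ M
              + (1 + Real.sqrt 2) ^ (R+1) * Real.sqrt 2 ^ M := by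
          have : (1 + Real.sqrt 2) * Real.sqrt 2 = 1 + (1 + Real.sqrt 2) := by linarith
          calc _ = (1 + Real.sqrt 2) ^ R * Real.sqrt 2 ^ M * ((1 + Real.sqrt 2) * Real.sqrt 2) := by
                ring
            _ = _ := by rw [this]; ring
        rw [this]
        ring
      · have : R = M + 1 := by omega
        subst this
        exact diag (M+1)

lemma choose_grow (M k j i : ℕ) (h : ((k:ℝ) + 2) * (2 + Real.sqrt 2) ≤ M + 2) (hk : j + i ≤ k) :
    (M.choose j : ℝ) * (1 + Real.sqrt 2) ^ i ≤ M.choose (j + i) := by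
  have s0 : 0 ≤ Real.sqrt 2 := Real.sqrt_nonneg 2
  induction i with
  | zero => simp
  | succ i ih =>
    have ih := ih (by omega)
    have hk' : ((j + i : ℕ) : ℝ) + 1 ≤ k := by exact_mod_cast hk
    set n := j + i with hn
    have hn0 : (0:ℝ) ≤ n := Nat.cast_nonneg n
    have hM : ((n:ℝ) + 1) * (1 + Real.sqrt 2) ≤ M - n := by nlinarith
    have hnM : n ≤ M := by
      have : (n:ℝ) ≤ M := by nlinarith
      exact_mod_cast this
    have e : (M.choose (n+1) : ℝ) * (n + 1) = M.choose n * (M - n) := by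
      have := Nat.choose_succ_right_eq M n
      rw [← Nat.cast_sub hnM]
      exact_mod_cast this
    have hc : (0:ℝ) ≤ M.choose n := Nat.cast_nonneg _
    have key : (M.choose n : ℝ) * (1 + Real.sqrt 2) ≤ M.choose (n+1) := by
      refine le_of_mul_le_mul_right ?_ (show (0:ℝ) < n + 1 by positivity)
      rw [e]
      nlinarith [mul_le_mul_of_nonneg_left hM hc]
    rw [pow_succ, ← mul_assoc]
    exact (mul_le_mul_of_nonneg_right ih (by positivity)).trans key

lemma Herr_le (M k : ℕ) (h : ((k:ℝ) + 2) * (2 + Real.sqrt 2) ≤ M + 2) :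
    4 * Herr (k+1) M ≤ ((k:ℝ) + 2) * (M+2).choose (k+2) := by
  have s0 : 0 ≤ Real.sqrt 2 := Real.sqrt_nonneg 2
  have h2 : Real.sqrt 2 * Real.sqrt 2 = 2 := Real.mul_self_sqrt (by norm_num)
  have h1 : Herr (k+1) M ≤ (k + 1) * (M.choose k * (1 + Real.sqrt 2)) := by
    unfold Herr
    have : ∀ j ∈ Finset.range (k+1), (M.choose j : ℝ) * (1 + Real.sqrt 2) ^ (k + 1 - j)
        ≤ M.choose k * (1 + Real.sqrt 2) := by
      intro j hj
      have hj := Finset.mem_range.mp hj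
      have e : k + 1 - j = (k - j) + 1 := by omega
      rw [e, pow_succ, ← mul_assoc]
      refine mul_le_mul_of_nonneg_right ?_ (by positivity)
      have := choose_grow M k j (k - j) h (by omega)
      rwa [show j + (k - j) = k by omega] at this
    refine (Finset.sum_le_card_nsmul _ _ _ this).trans (le_of_eq ?_)
    simp
  have e1 : ((M:ℝ) + 2) * (M + 1) * M.choose k = (M+2).choose (k+2) * (k + 2) * (k + 1) := by
    have a := Nat.add_one_mul_choose_eq M k
    have b := Nat.add_one_mul_choose_eq (M+1) (k+1)
    have a' : ((M:ℝ) + 1) * M.choose k = (M+1).choose (k+1) * (k+1) := by exact_mod_cast a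
    have b' : ((M:ℝ) + 1 + 1) * (M+1).choose (k+1) = (M+2).choose (k+2) * (k+1+1) := by
      exact_mod_cast b
    linear_combination ((M:ℝ) + 2) * a' + ((k:ℝ) + 1) * b'
  have k0 : (0:ℝ) ≤ k := Nat.cast_nonneg k
  have hc : (0:ℝ) ≤ M.choose k := Nat.cast_nonneg _
  have h3 : ((k:ℝ) + 1) * (2 + Real.sqrt 2) ≤ M + 1 := by nlinarith
  have h4 : (((k:ℝ) + 2) * (2 + Real.sqrt 2)) * (((k:ℝ) + 1) * (2 + Real.sqrt 2))
      ≤ (M + 2) * (M + 1) := mul_le_mul h h3 (by positivity) (by positivity)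
  have h5 : (M.choose k : ℝ) * (2 + Real.sqrt 2) ^ 2 ≤ (M+2).choose (k+2) := by
    refine le_of_mul_le_mul_right ?_ (show (0:ℝ) < (k + 2) * (k + 1) by positivity)
    have := mul_le_mul_of_nonneg_right h4 hc
    nlinarith
  have h6 : (M.choose k : ℝ) * (4 * (1 + Real.sqrt 2)) ≤ (M+2).choose (k+2) := by
    refine le_trans (mul_le_mul_of_nonneg_left ?_ hc) h5
    nlinarith
  have h7 : (0:ℝ) ≤ (M+2).choose (k+2) := Nat.cast_nonneg _
  have h8 := mul_le_mul_of_nonneg_left h6 (show (0:ℝ) ≤ k + 1 by positivity)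
  nlinarith

/-- for m ≥ 3 and 2 ≤ r ≤ m/(2+√2),
R_t(r,m) ≤ (1 − 1/2^t)2^m − (√(2^t−1)/2^t)(1+√2)^{r−1}2^{(m−1)/2}
           + (√(2^t−1)/(2^t·2^{1/4}))·r·C(m,r). -/
theorem stmt14 (m t r : ℕ) (hm : 3 ≤ m) (hr : 2 ≤ r)
    (hrm : (r : ℝ) ≤ (m : ℝ) / (2 + Real.sqrt 2)) :
    (genCovRadius (RM r m) t : ℝ) ≤
      (1 - 1 / 2 ^ t) * 2 ^ m
        - (Real.sqrt (2 ^ t - 1) / 2 ^ t) * (1 + Real.sqrt 2) ^ (r - 1)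
            * (2 : ℝ) ^ (((m : ℝ) - 1) / 2)
        + (Real.sqrt (2 ^ t - 1) / (2 ^ t * (2 : ℝ) ^ ((1 : ℝ) / 4))) * (r : ℝ)
            * (m.choose r : ℝ) := by
  have s0 : 0 ≤ Real.sqrt 2 := Real.sqrt_nonneg 2
  rcases Nat.eq_zero_or_pos t with ht | ht
  · subst ht
    have : Cov r m 0 0 := fun v => ⟨v, fun i => i.elim0, by simp [genCovDist, tWeight]⟩
    simpa using this.radius_le
  obtain ⟨k, rfl⟩ : ∃ k, r = k + 2 := ⟨r - 2, by omega⟩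
  obtain ⟨M, rfl⟩ : ∃ M, m = M + 2 := ⟨m - 2, by omega⟩
  have h : ((k:ℝ) + 2) * (2 + Real.sqrt 2) ≤ M + 2 := by
    rw [le_div_iff₀ (by positivity)] at hrm
    exact_mod_cast hrm
  have hk : k + 1 ≤ M + 1 := by
    have k0 : (0:ℝ) ≤ k := Nat.cast_nonneg k
    have : (k:ℝ) ≤ M := by nlinarith
    have : k ≤ M := by exact_mod_cast this
    omega
  refine (Cov.main t ht M (k+1) hk).radius_le.trans ?_
  have hH := Herr_le M k h
  have p1 : (2:ℝ) ^ ((((M + 2 : ℕ) : ℝ) - 1) / 2) ≤ 2 * Real.sqrt 2 ^ M := by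
    have : 2 * Real.sqrt 2 ^ M = (2:ℝ) ^ (((M:ℝ) + 2) / 2) := by
      rw [Real.sqrt_eq_rpow, ← Real.rpow_natCast, ← Real.rpow_mul (by norm_num)]
      rw [show ((M:ℝ) + 2) / 2 = 1 + 1 / 2 * M by ring, Real.rpow_add (by norm_num), Real.rpow_one]
    rw [this]
    apply Real.rpow_le_rpow_of_exponent_le (by norm_num)
    push_cast
    linarith
  have p2 : (2:ℝ) ^ ((1:ℝ) / 4) ≤ 2 := by
    calc (2:ℝ) ^ ((1:ℝ) / 4) ≤ 2 ^ (1:ℝ) :=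
          Real.rpow_le_rpow_of_exponent_le (by norm_num) (by norm_num)
      _ = 2 := Real.rpow_one 2
  have p2' : (0:ℝ) < 2 ^ ((1:ℝ) / 4) := by positivity
  set a : ℝ := (2:ℝ) ^ ((1:ℝ) / 4) with ha
  set b : ℝ := (2:ℝ) ^ ((((M + 2 : ℕ) : ℝ) - 1) / 2) with hb
  have hS : 0 ≤ Real.sqrt (2 ^ t - 1) / 2 ^ t := by positivity
  rw [← div_div]
  set S := Real.sqrt (2 ^ t - 1) / 2 ^ t with hSdef
  have hC : (0:ℝ) ≤ ((k:ℝ) + 2) * (M+2).choose (k+2) := by positivity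
  have q2 : 2 * Herr (k+1) M ≤ ((k:ℝ) + 2) * (M+2).choose (k+2) / a := by
    rw [le_div_iff₀ p2']
    have := mul_le_mul_of_nonneg_right hH p2'.le
    nlinarith
  have q1 := mul_le_mul_of_nonneg_left p1 (show 0 ≤ (1 + Real.sqrt 2) ^ (k+1) by positivity)
  have q := mul_le_mul_of_nonneg_left (add_le_add q1 q2) hS
  rw [show k + 2 - 1 = k + 1 by omega]
  push_cast
  have e : S / a * ((k:ℝ) + 2) * (M+2).choose (k+2)
      = S * (((k:ℝ) + 2) * (M+2).choose (k+2) / a) := by ring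
  rw [e]
  linarith
end
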